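/- Roots are quickly reached: under the stated assumptions, max_{x∈X} P^h(x, X∖R) converges to 0 in probability as n → ∞, where R is the set of roots and h := ⌊min(log N/(10 log Δ), log log N)⌋. -/

import Mathlib

open Classical Filter Finset

noncomputable section

/-- The set of half-edges: `deg v` half-edges attached to each vertex `v`. -/
abbrev HE (k : ℕ) (dg : Fin k → ℕ) : Type := (v : Fin k) × Fin (dg v)

/-- A pairing is a fixed-point-free involution of the half-edges. -/
def IsPairing {k : ℕ} {dg : Fin k → ℕ} (π : Equiv.Perm (HE k dg)) : Prop :=
  (∀ x, π (π x) = x) ∧ ∀ x, π x ≠ x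

/-- `N`, the total number of half-edges. -/
def Nh {k : ℕ} (dg : Fin k → ℕ) : ℕ := ∑ v, dg v

/-- The non-backtracking random walk transition matrix: from `x`, move to a uniformly
chosen neighbour of `π x` (a half-edge at the same vertex as `π x`, distinct from it). -/
def nbrwP {k : ℕ} (dg : Fin k → ℕ) (π : Equiv.Perm (HE k dg)) :
    Matrix (HE k dg) (HE k dg) ℝ := fun x y =>
  if (π x).1 = y.1 ∧ π x ≠ y then ((dg (π x).1 : ℝ) - 1)⁻¹ else 0

/-- Total-variation distance to the uniform distribution at time `t`, from state `x`. -/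
def Dx {k : ℕ} (dg : Fin k → ℕ) (π : Equiv.Perm (HE k dg)) (x : HE k dg) (t : ℕ) : ℝ :=
  (1 / 2) * ∑ y, |((nbrwP dg π) ^ t) x y - (Nh dg : ℝ)⁻¹|

/-- Worst-case total-variation distance to equilibrium at time `t`. -/
def Dmax {k : ℕ} (dg : Fin k → ℕ) (π : Equiv.Perm (HE k dg)) (t : ℕ) : ℝ :=
  ⨆ x, Dx dg π x t

/-- Mixing time. -/
def tmixT {k : ℕ} (dg : Fin k → ℕ) (π : Equiv.Perm (HE k dg)) (ε : ℝ) : ℕ :=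
  sInf {t : ℕ | Dmax dg π t < ε}

/-- The finite set of all pairings of the half-edges. -/
def PairingsF {k : ℕ} (dg : Fin k → ℕ) : Finset (Equiv.Perm (HE k dg)) :=
  univ.filter IsPairing

/-- Probability of an event under the uniformly random pairing. -/
def prP {k : ℕ} (dg : Fin k → ℕ) (Q : Equiv.Perm (HE k dg) → Prop) : ℝ :=
  (((PairingsF dg).filter Q).card : ℝ) / ((PairingsF dg).card : ℝ)

/-- Mean logarithmic degree `μ` of a uniform half-edge. -/
def muD {k : ℕ} (dg : Fin k → ℕ) : ℝ :=
  (Nh dg : ℝ)⁻¹ * ∑ v, (dg v : ℝ) * Real.log ((dg v : ℝ) - 1)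

/-- Variance `σ²` of the logarithmic degree of a uniform half-edge. -/
def sigsq {k : ℕ} (dg : Fin k → ℕ) : ℝ :=
  (Nh dg : ℝ)⁻¹ * ∑ v, (dg v : ℝ) * (Real.log ((dg v : ℝ) - 1) - muD dg) ^ 2

/-- Third absolute central moment `ϱ`. -/
def rhoD {k : ℕ} (dg : Fin k → ℕ) : ℝ :=
  (Nh dg : ℝ)⁻¹ * ∑ v, (dg v : ℝ) * |Real.log ((dg v : ℝ) - 1) - muD dg| ^ 3

/-- Maximum degree `Δ`. -/
def DeltaD {k : ℕ} (dg : Fin k → ℕ) : ℕ := univ.sup dg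

/-- The standard normal tail function `Φ`. -/
def Phi (lam : ℝ) : ℝ :=
  (Real.sqrt (2 * Real.pi))⁻¹ * ∫ u in Set.Ioi lam, Real.exp (-u ^ 2 / 2)

/-- Cutoff time `t⋆ = log N / μ`. -/
def tstar {k : ℕ} (dg : Fin k → ℕ) : ℝ := Real.log (Nh dg) / muD dg

/-- Cutoff window `ω⋆ = √(σ² log N / μ³)`. -/
def wstar {k : ℕ} (dg : Fin k → ℕ) : ℝ :=
  Real.sqrt (sigsq dg * Real.log (Nh dg) / (muD dg) ^ 3)

/-- `IsNBPath π p`: the list `p` of half-edges is a non-backtracking path,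
each element being a neighbour of the image under `π` of the previous one. -/
def IsNBPath {k : ℕ} {dg : Fin k → ℕ} (π : Equiv.Perm (HE k dg)) :
    List (HE k dg) → Prop
  | [] => True
  | [_] => True
  | x :: y :: r => ((π x).1 = y.1 ∧ π x ≠ y) ∧ IsNBPath π (y :: r)

/-- `x` is a root: the ball of radius `h` around `x` is a tree, i.e. every half-edge
reachable in at most `h` non-backtracking steps from `x` is reached by a unique
non-backtracking path. -/
def IsRoot {k : ℕ} (dg : Fin k → ℕ) (π : Equiv.Perm (HE k dg)) (h : ℕ)
    (x : HE k dg) : Prop :=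
  ∀ p q : List (HE k dg), IsNBPath π p → IsNBPath π q →
    p.head? = some x → q.head? = some x →
    p.length ≤ h + 1 → q.length ≤ h + 1 →
    p.getLast? = q.getLast? → p = q

/-- `y` belongs to the ball of radius `h` around `x` (reachable in `≤ h` NBRW steps). -/
def InBall {k : ℕ} (dg : Fin k → ℕ) (π : Equiv.Perm (HE k dg)) (h : ℕ)
    (x y : HE k dg) : Prop :=
  ∃ s ≤ h, ((nbrwP dg π) ^ s) x y ≠ 0

/-- The radius `h = ⌊min(log N / (10 log Δ), log log N)⌋`. -/
def hrad {k : ℕ} (dg : Fin k → ℕ) : ℕ :=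
  ⌊min (Real.log (Nh dg) / (10 * Real.log (DeltaD dg)))
      (Real.log (Real.log (Nh dg)))⌋₊

section Exploration

variable {H V : Type*} [Fintype H] [DecidableEq V]

lemma card_filter_vert_le {vert : H → V} {Δ : ℕ}
    (hΔ : ∀ v, (univ.filter fun y => vert y = v).card ≤ Δ) (S : Finset V) :
    (univ.filter fun y => vert y ∈ S).card ≤ S.card * Δ := by
  have h := Finset.card_eq_sum_card_fiberwise (f := vert)
    (s := univ.filter fun y => vert y ∈ S) (t := S) (fun y hy => by simpa using hy)
  rw [h, ← smul_eq_mul]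
  refine Finset.sum_le_card_nsmul _ _ _ fun v _ => le_trans (Finset.card_le_card ?_) (hΔ v)
  intro y hy
  simp only [mem_filter, mem_univ, true_and] at hy ⊢
  exact hy.2

variable [DecidableEq H]

/-- Starting from a set `S` of discovered vertices and a set `D` of matched half-edges, one can
reveal at most `m` further edges, each having an endpoint among the discovered vertices, so that at
least `c` of them join two vertices already discovered. -/
def HasCollisions (vert : H → V) (π : Equiv.Perm H) : ℕ → ℕ → Finset V → Finset H → Prop
  | _, 0, _, _ => True
  | 0, _ + 1, _, _ => False
  | m + 1, c + 1, S, D => ∃ a, a ∉ D ∧ vert a ∈ S ∧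
      ((vert (π a) ∈ S ∧ HasCollisions vert π m c S (insert a (insert (π a) D))) ∨
        HasCollisions vert π m (c + 1) (insert (vert (π a)) S) (insert a (insert (π a) D)))

/-- The fixed-point-free involutions agreeing with `σ` on `D`. -/
def pairingsAgreeing (D : Finset H) (σ : Equiv.Perm H) : Finset (Equiv.Perm H) :=
  univ.filter fun π => ((∀ x, π (π x) = x) ∧ ∀ x, π x ≠ x) ∧ ∀ d ∈ D, π d = σ d

lemma card_filter_apply_eq_le {D : Finset H} {σ : Equiv.Perm H} {a b b' : H}
    (hb : b ∉ D) (hb' : b' ∉ D) (hab : a ≠ b) (hab' : a ≠ b')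
    (hD : ∀ d ∈ D, σ d ∈ D) :
    ((pairingsAgreeing D σ).filter fun π => π a = b).card ≤
      ((pairingsAgreeing D σ).filter fun π => π a = b').card := by
  refine Finset.card_le_card_of_injOn
    (fun π => Equiv.swap b b' * π * Equiv.swap b b') ?_ ?_
  · intro π hπ
    simp only [pairingsAgreeing, coe_filter, mem_filter, mem_univ, true_and, Set.mem_ofPred_eq,
      Equiv.Perm.mul_apply] at hπ ⊢
    obtain ⟨⟨⟨hinv, hfix⟩, hag⟩, hπa⟩ := hπ
    refine ⟨⟨⟨fun x => ?_, fun x hx => ?_⟩, fun d hd => ?_⟩, ?_⟩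
    · simp [hinv]
    · apply hfix (Equiv.swap b b' x)
      have := congrArg (Equiv.swap b b') hx
      simpa using this
    · have hne : ∀ e ∈ D, Equiv.swap b b' e = e := fun e he =>
        Equiv.swap_apply_of_ne_of_ne (fun h => hb (h ▸ he)) (fun h => hb' (h ▸ he))
      rw [hne d hd, hag d hd, hne _ (hD d hd)]
    · rw [Equiv.swap_apply_of_ne_of_ne hab hab', hπa, Equiv.swap_apply_left]
  · intro π _ π' _ h
    simpa using h

lemma mul_card_filter_apply_eq_le {D : Finset H} {σ : Equiv.Perm H} {a b : H}
    (ha : a ∉ D) (hD : ∀ d ∈ D, σ d ∈ D) :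
    ((Fintype.card H : ℝ) - D.card - 1) *
        ((pairingsAgreeing D σ).filter fun π => π a = b).card ≤
      (pairingsAgreeing D σ).card := by
  by_cases hab : a = b ∨ b ∈ D
  · have : ((pairingsAgreeing D σ).filter fun π => π a = b) = ∅ := by
      refine Finset.filter_eq_empty_iff.2 fun π hπ hπa => ?_
      simp only [pairingsAgreeing, mem_filter, mem_univ, true_and] at hπ
      obtain ⟨⟨hinv, hfix⟩, hag⟩ := hπ
      rcases hab with rfl | hb
      · exact hfix _ hπa
      · have h1 := hD b hb
        rw [← hag b hb, ← hπa, hinv] at h1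
        exact ha h1
    simp [this]
  · rw [not_or] at hab
    have hsum : ∑ b' ∈ univ \ insert a D,
        ((pairingsAgreeing D σ).filter fun π => π a = b').card ≤ (pairingsAgreeing D σ).card :=
      (Finset.sum_le_sum_of_subset (Finset.subset_univ _)).trans
        (Finset.card_eq_sum_card_fiberwise (f := fun π : Equiv.Perm H => π a) (t := univ)
          (fun _ _ => by simp)).ge
    have hle := Finset.card_nsmul_le_sum (univ \ insert a D)
      (fun b' => ((pairingsAgreeing D σ).filter fun π => π a = b').card)
      ((pairingsAgreeing D σ).filter fun π => π a = b).card (fun b' hb' => by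
        simp only [Finset.mem_sdiff, mem_univ, mem_insert, true_and, not_or] at hb'
        exact card_filter_apply_eq_le hab.2 hb'.2 hab.1 (Ne.symm hb'.1) hD)
    have hcard : ((univ \ insert a D).card : ℝ) = (Fintype.card H : ℝ) - D.card - 1 := by
      rw [Finset.cast_card_sdiff (Finset.subset_univ _), Finset.card_insert_of_notMem ha,
        Finset.card_univ]
      push_cast
      ring
    rw [← hcard]
    have h2 := hle.trans hsum
    rw [smul_eq_mul] at h2
    exact_mod_cast h2

lemma pairingsAgreeing_insert {D : Finset H} {σ π₀ : Equiv.Perm H} {a b : H}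
    (h₀ : π₀ ∈ (pairingsAgreeing D σ).filter fun π => π a = b) :
    ((pairingsAgreeing D σ).filter fun π => π a = b) =
      pairingsAgreeing (insert a (insert b D)) π₀ := by
  ext π
  simp only [pairingsAgreeing, mem_filter, mem_univ, true_and, mem_insert, forall_eq_or_imp]
    at h₀ ⊢
  obtain ⟨⟨⟨hinv₀, -⟩, hag₀⟩, h₀a⟩ := h₀
  have h₀b : π₀ b = a := by rw [← h₀a, hinv₀]
  constructor
  · rintro ⟨⟨⟨hinv, hfix⟩, hag⟩, hπa⟩
    exact ⟨⟨hinv, hfix⟩, by rw [hπa, h₀a], by rw [h₀b, ← hπa, hinv],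
      fun d hd => by rw [hag d hd, hag₀ d hd]⟩
  · rintro ⟨⟨hinv, hfix⟩, hπa, -, hag⟩
    exact ⟨⟨⟨hinv, hfix⟩, fun d hd => by rw [hag d hd, hag₀ d hd]⟩, by rw [hπa, h₀a]⟩

/-- Revealing a uniformly random pairing edge by edge, each collision costs a factor `ε`. -/
lemma card_hasCollisions_le {vert : H → V} {Δ : ℕ} {s ε : ℝ}
    (hΔ : ∀ v, (univ.filter fun y => vert y = v).card ≤ Δ) (hs : 1 ≤ s) (hε : 0 ≤ ε)
    (m c : ℕ) (S : Finset V) (D : Finset H) (σ : Equiv.Perm H)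
    (hD : ∀ d ∈ D, σ d ∈ D) (hS : ((S.card : ℝ) + m) * Δ ≤ s)
    (hsε : s ≤ ε * ((Fintype.card H : ℝ) - D.card - 2 * m)) :
    (((pairingsAgreeing D σ).filter fun π => HasCollisions vert π m c S D).card : ℝ) ≤
      (2 * s) ^ m * ε ^ c * (pairingsAgreeing D σ).card := by
  induction m generalizing c S D σ with
  | zero =>
    cases c with
    | zero => simpa using card_filter_le _ _
    | succ c => 
      have : ((pairingsAgreeing D σ).filter fun π => HasCollisions vert π 0 (c + 1) S D) = ∅ :=
        Finset.filter_eq_empty_iff.2 fun π _ h => h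
      simp only [this, card_empty, Nat.cast_zero]
      have : 0 ≤ s := by linarith
      positivity
  | succ m ih =>
    cases c with
    | zero =>
      rw [pow_zero, mul_one]
      exact (Nat.cast_le.2 (card_filter_le _ _)).trans
        (le_mul_of_one_le_left (Nat.cast_nonneg _) (one_le_pow₀ (by linarith)))
    | succ c =>
      push_cast at hS hsε
      set C := pairingsAgreeing D σ with hC
      set A := univ.filter fun y => vert y ∈ S with hA
      have hAcard : (A.card : ℝ) ≤ s := by
        have h1 : (A.card : ℝ) ≤ S.card * Δ := by exact_mod_cast card_filter_vert_le hΔ S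
        have h2 : (0 : ℝ) ≤ (m + 1 : ℝ) * Δ := by positivity
        nlinarith
      have hrec : ∀ a ∉ D, ∀ b, ∀ c' S', (S'.card : ℝ) ≤ S.card + 1 →
          (((C.filter fun π => π a = b).filter fun π =>
            HasCollisions vert π m c' S' (insert a (insert b D))).card : ℝ) ≤
            (2 * s) ^ m * ε ^ c' * (C.filter fun π => π a = b).card := by
        intro a ha b c' S' hS'
        rcases (C.filter fun π => π a = b).eq_empty_or_nonempty with h | ⟨π₀, h₀⟩
        · simp [h]
        · rw [pairingsAgreeing_insert h₀]
          simp only [hC, pairingsAgreeing, mem_filter, mem_univ, true_and] at h₀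
          obtain ⟨⟨⟨hinv₀, -⟩, hag₀⟩, h₀a⟩ := h₀
          have hcard : ((insert a (insert b D)).card : ℝ) ≤ D.card + 2 := by
            exact_mod_cast (Finset.card_insert_le _ _).trans
              (Nat.add_le_add_right (Finset.card_insert_le _ _) 1)
          refine ih c' S' _ π₀ ?_ ?_ ?_
          · intro d hd
            simp only [mem_insert] at hd ⊢
            rcases hd with rfl | rfl | hd
            · simp [h₀a]
            · left; rw [← h₀a, hinv₀]
            · right; right; rw [hag₀ d hd]; exact hD d hd
          · exact (mul_le_mul_of_nonneg_right (by linarith) (Nat.cast_nonneg _)).trans hS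
          · exact hsε.trans (mul_le_mul_of_nonneg_left (by linarith) hε)
      have hsub : (C.filter fun π => HasCollisions vert π (m + 1) (c + 1) S D) ⊆
          (A \ D).biUnion fun a =>
            (A.biUnion fun b => (C.filter fun π => π a = b).filter fun π =>
              HasCollisions vert π m c S (insert a (insert b D))) ∪
            (univ.biUnion fun b => (C.filter fun π => π a = b).filter fun π =>
              HasCollisions vert π m (c + 1) (insert (vert b) S) (insert a (insert b D))) := by
        intro π hπ
        rw [mem_filter] at hπ
        obtain ⟨hπC, a, haD, haS, hor⟩ := hπ
        simp only [mem_biUnion, mem_union, mem_filter, Finset.mem_sdiff, hA, mem_univ, true_and]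
        refine ⟨a, ⟨haS, haD⟩, ?_⟩
        rcases hor with ⟨h1, h2⟩ | h2
        · exact Or.inl ⟨π a, h1, ⟨hπC, rfl⟩, h2⟩
        · exact Or.inr ⟨π a, ⟨hπC, rfl⟩, h2⟩
      have hfst : ∀ a ∉ D, ∀ b, (2 * s) ^ m * ε ^ c * ((C.filter fun π => π a = b).card : ℝ) * s ≤
          (2 * s) ^ m * ε ^ (c + 1) * C.card := by
        intro a ha b
        have h1 := mul_card_filter_apply_eq_le (b := b) ha hD
        have h2 : s * ((C.filter fun π => π a = b).card : ℝ) ≤ ε * C.card := by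
          calc s * ((C.filter fun π => π a = b).card : ℝ)
              ≤ (ε * ((Fintype.card H : ℝ) - D.card - 1)) *
                  (C.filter fun π => π a = b).card := by
                gcongr
                have : (0 : ℝ) ≤ m := Nat.cast_nonneg m
                exact hsε.trans (mul_le_mul_of_nonneg_left (by linarith) hε)
            _ = ε * (((Fintype.card H : ℝ) - D.card - 1) *
                  (C.filter fun π => π a = b).card) := by ring
            _ ≤ ε * C.card := by gcongr
        calc (2 * s) ^ m * ε ^ c * ((C.filter fun π => π a = b).card : ℝ) * s
            = (2 * s) ^ m * ε ^ c * (s * ((C.filter fun π => π a = b).card : ℝ)) := by ring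
          _ ≤ (2 * s) ^ m * ε ^ c * (ε * C.card) := by gcongr
          _ = _ := by ring
      have hone : ∀ a ∈ A \ D, ((((A.biUnion fun b => (C.filter fun π => π a = b).filter fun π =>
              HasCollisions vert π m c S (insert a (insert b D))) ∪
            (univ.biUnion fun b => (C.filter fun π => π a = b).filter fun π =>
              HasCollisions vert π m (c + 1) (insert (vert b) S)
                (insert a (insert b D)))).card : ℕ) : ℝ) ≤
            2 * ((2 * s) ^ m * ε ^ (c + 1) * C.card) := by
        intro a ha
        have haD : a ∉ D := (Finset.mem_sdiff.1 ha).2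
        have hfiber : (∑ b, ((C.filter fun π => π a = b).card : ℝ)) = C.card := by
          rw [Finset.card_eq_sum_card_fiberwise (f := fun π : Equiv.Perm H => π a) (t := univ)
            (s := C) (fun _ _ => by simp)]
          push_cast
          rfl
        have hB1 : (((A.biUnion fun b => (C.filter fun π => π a = b).filter fun π =>
              HasCollisions vert π m c S (insert a (insert b D))).card : ℕ) : ℝ) ≤
              (2 * s) ^ m * ε ^ (c + 1) * C.card := by
          calc _ ≤ ∑ b ∈ A, (((C.filter fun π => π a = b).filter fun π =>
                  HasCollisions vert π m c S (insert a (insert b D))).card : ℝ) := by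
                exact_mod_cast Finset.card_biUnion_le
            _ ≤ ∑ b ∈ A, (2 * s) ^ m * ε ^ (c + 1) * C.card / s := by
                refine Finset.sum_le_sum fun b _ => ?_
                rw [le_div_iff₀ (by linarith)]
                refine le_trans ?_ (hfst a haD b)
                gcongr
                exact hrec a haD b c S (by linarith)
            _ = A.card * ((2 * s) ^ m * ε ^ (c + 1) * C.card / s) := by simp
            _ ≤ s * ((2 * s) ^ m * ε ^ (c + 1) * C.card / s) := by gcongr
            _ = _ := by field_simp
        have hB2 : (((univ.biUnion fun b => (C.filter fun π => π a = b).filter fun π =>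
              HasCollisions vert π m (c + 1) (insert (vert b) S)
                (insert a (insert b D))).card : ℕ) : ℝ) ≤
              (2 * s) ^ m * ε ^ (c + 1) * C.card := by
          calc _ ≤ ∑ b, (((C.filter fun π => π a = b).filter fun π =>
                  HasCollisions vert π m (c + 1) (insert (vert b) S)
                    (insert a (insert b D))).card : ℝ) := by
                exact_mod_cast Finset.card_biUnion_le
            _ ≤ ∑ b, (2 * s) ^ m * ε ^ (c + 1) * ((C.filter fun π => π a = b).card : ℝ) :=
                Finset.sum_le_sum fun b _ => hrec a haD b (c + 1) _
                  (by exact_mod_cast Finset.card_insert_le _ _)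
            _ = _ := by rw [← Finset.mul_sum, hfiber]
        have h3 := Finset.card_union_le
          (A.biUnion fun b => (C.filter fun π => π a = b).filter fun π =>
              HasCollisions vert π m c S (insert a (insert b D)))
          (univ.biUnion fun b => (C.filter fun π => π a = b).filter fun π =>
              HasCollisions vert π m (c + 1) (insert (vert b) S) (insert a (insert b D)))
        have h4 : ((_ : ℕ) : ℝ) ≤ ((_ : ℕ) : ℝ) := Nat.cast_le.2 h3
        push_cast at h4
        linarith
      calc _ ≤ ∑ a ∈ A \ D, ((((A.biUnion fun b => (C.filter fun π => π a = b).filter fun π =>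
              HasCollisions vert π m c S (insert a (insert b D))) ∪
            (univ.biUnion fun b => (C.filter fun π => π a = b).filter fun π =>
              HasCollisions vert π m (c + 1) (insert (vert b) S)
                (insert a (insert b D)))).card : ℕ) : ℝ) := by
            exact_mod_cast (Finset.card_le_card hsub).trans Finset.card_biUnion_le
        _ ≤ (A \ D).card * (2 * ((2 * s) ^ m * ε ^ (c + 1) * C.card)) := by
            rw [← nsmul_eq_mul]
            exact Finset.sum_le_card_nsmul _ _ _ hone
        _ ≤ s * (2 * ((2 * s) ^ m * ε ^ (c + 1) * C.card)) := by
            gcongr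
            refine le_trans ?_ hAcard
            exact_mod_cast Finset.card_le_card Finset.sdiff_subset
        _ = _ := by ring

end Exploration

/-- A connected set of edges with more edges than vertices can be revealed with two collisions. -/
lemma hasCollisions_of_connected {H V : Type*} [DecidableEq H] [DecidableEq V] {vert : H → V}
    {π : Equiv.Perm H} {F : Finset H} {u : V}
    (hinv : ∀ x, π (π x) = x) (hfix : ∀ x, π x ≠ x) (hF : ∀ a ∈ F, π a ∈ F)
    (hconn : ∀ D ⊆ F, (∀ a ∈ D, π a ∈ D) → D ≠ F →
      ∃ a ∈ F, a ∉ D ∧ vert a ∈ insert u (D.image vert))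
    (m c : ℕ) (D : Finset H) (hDF : D ⊆ F) (hD : ∀ a ∈ D, π a ∈ D)
    (hm : (F \ D).card ≤ 2 * m)
    (hc : 2 * ((F.image vert \ insert u (D.image vert)).card + c) ≤ (F \ D).card + 1) :
    HasCollisions vert π m c (insert u (D.image vert)) D := by
  induction m generalizing c D with
  | zero =>
    obtain rfl : c = 0 := by omega
    simp [HasCollisions]
  | succ m ih =>
    cases c with
    | zero => simp [HasCollisions]
    | succ c =>
      have hne : D ≠ F := by
        rintro rfl
        rw [Finset.sdiff_self, Finset.card_empty] at hc
        omega
      obtain ⟨a, haF, haD, haS⟩ := hconn D hDF hD hne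
      have hbD : π a ∉ D := fun h => haD (by simpa [hinv] using hD _ h)
      have hsub : insert a (insert (π a) D) ⊆ F := by
        intro y hy
        simp only [mem_insert] at hy
        rcases hy with rfl | rfl | hy
        exacts [haF, hF _ haF, hDF hy]
      have hcl : ∀ y ∈ insert a (insert (π a) D), π y ∈ insert a (insert (π a) D) := by
        intro y hy
        simp only [mem_insert] at hy ⊢
        rcases hy with rfl | rfl | hy
        exacts [Or.inr (Or.inl rfl), Or.inl (hinv _), Or.inr (Or.inr (hD _ hy))]
      have hcard : (F \ insert a (insert (π a) D)).card + 2 = (F \ D).card := by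
        rw [Finset.card_sdiff_of_subset hsub, Finset.card_sdiff_of_subset hDF,
          Finset.card_insert_of_notMem (by simp [haD, Ne.symm (hfix a)]),
          Finset.card_insert_of_notMem hbD]
        have := Finset.card_le_card hsub
        rw [Finset.card_insert_of_notMem (by simp [haD, Ne.symm (hfix a)]),
          Finset.card_insert_of_notMem hbD] at this
        omega
      have himage : insert u ((insert a (insert (π a) D)).image vert) =
          insert (vert (π a)) (insert u (D.image vert)) := by
        rw [Finset.image_insert, Finset.image_insert]
        grind
      refine ⟨a, haD, haS, ?_⟩
      by_cases hb : vert (π a) ∈ insert u (D.image vert)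
      · have himage' := himage.trans (Finset.insert_eq_of_mem hb)
        refine Or.inl ⟨hb, ?_⟩
        have := ih c _ hsub hcl (by omega) (by rw [himage']; omega)
        rwa [himage'] at this
      · refine Or.inr ?_
        have hlt : (F.image vert \ insert (vert (π a)) (insert u (D.image vert))).card <
            (F.image vert \ insert u (D.image vert)).card := by
          refine Finset.card_lt_card (Finset.ssubset_iff_of_subset ?_ |>.2
            ⟨vert (π a), ?_, ?_⟩)
          · exact Finset.sdiff_subset_sdiff subset_rfl (Finset.subset_insert _ _)
          · exact Finset.mem_sdiff.2 ⟨mem_image_of_mem _ (hF _ haF), hb⟩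
          · simp
        have := ih (c + 1) _ hsub hcl (by omega) (by rw [himage]; omega)
        rwa [himage] at this

section Lasso

variable {H V : Type*}

/-- Two distinct non-backtracking paths from `x` with the same end, sharing their first `h` steps,
and such that no two final steps can be cut off simultaneously. -/
structure Lasso (vert : H → V) (π : Equiv.Perm H) (x : H) (h : ℕ) where
  w : ℕ → H
  w' : ℕ → H
  l : ℕ
  l' : ℕ
  le_l : h ≤ l
  le_l' : h ≤ l'
  l_le : l ≤ 2 * h
  l'_le : l' ≤ 2 * h
  start : w 0 = x
  agree : ∀ j ≤ h, w j = w' j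
  step : ∀ j < l, vert (π (w j)) = vert (w (j + 1)) ∧ π (w j) ≠ w (j + 1)
  step' : ∀ j < l', vert (π (w' j)) = vert (w' (j + 1)) ∧ π (w' j) ≠ w' (j + 1)
  last : w l = w' l'
  ne : ¬ (l = l' ∧ ∀ j ≤ l, w j = w' j)
  tail : l = h ∨ l' = h ∨ w (l - 1) ≠ w' (l' - 1)

namespace Lasso

variable {vert : H → V} {π : Equiv.Perm H} {x : H} {h : ℕ}

lemma h_lt (b : Lasso vert π x h) : h < b.l ∨ h < b.l' := by
  by_contra hcon
  have h1 := b.le_l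
  have h2 := b.le_l'
  exact b.ne ⟨by omega, fun j hj => b.agree j (by omega)⟩

variable [DecidableEq H]

/-- The half-edges matched along the two paths. -/
def edges (b : Lasso vert π x h) : Finset H :=
  ((range b.l).image b.w ∪ (range b.l').image b.w') ∪
    ((range b.l).image b.w ∪ (range b.l').image b.w').image π

/-- Exchange the two paths. -/
def swap (b : Lasso vert π x h) : Lasso vert π x h where
  w := b.w'
  w' := b.w
  l := b.l'
  l' := b.l
  le_l := b.le_l'
  le_l' := b.le_l
  l_le := b.l'_le
  l'_le := b.l_le
  start := (b.agree 0 (Nat.zero_le _)).symm.trans b.start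
  agree j hj := (b.agree j hj).symm
  step := b.step'
  step' := b.step
  last := b.last.symm
  ne hn := b.ne ⟨hn.1.symm, fun j hj => (hn.2 j (hn.1 ▸ hj)).symm⟩
  tail := by
    rcases b.tail with h | h | h
    exacts [Or.inr (Or.inl h), Or.inl h, Or.inr (Or.inr h.symm)]

lemma edges_swap (b : Lasso vert π x h) : b.swap.edges = b.edges := by
  simp only [edges, swap]
  rw [Finset.union_comm ((range b.l').image b.w')]

lemma w_mem (b : Lasso vert π x h) {j : ℕ} (hj : j < b.l) : b.w j ∈ b.edges := by
  simp only [edges, mem_union, mem_image, mem_range]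
  exact Or.inl (Or.inl ⟨j, hj, rfl⟩)

lemma w'_mem (b : Lasso vert π x h) {j : ℕ} (hj : j < b.l') : b.w' j ∈ b.edges :=
  b.edges_swap ▸ b.swap.w_mem hj

lemma apply_mem (b : Lasso vert π x h) (hinv : ∀ x, π (π x) = x) {a : H} (ha : a ∈ b.edges) :
    π a ∈ b.edges := by
  rw [edges, mem_union] at ha ⊢
  rcases ha with ha | ha
  · exact Or.inr (mem_image_of_mem _ ha)
  · obtain ⟨y, hy, rfl⟩ := mem_image.1 ha
    rw [hinv]
    exact Or.inl hy

lemma w_mem_of_le (b : Lasso vert π x h) {j : ℕ} (hj : j ≤ h) : b.w j ∈ b.edges := by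
  rcases b.h_lt with hlt | hlt
  · exact b.w_mem (by omega)
  · exact b.agree j hj ▸ b.w'_mem (by omega)

lemma induction_edges (b : Lasso vert π x h) {P : H → Prop}
    (hw : ∀ b' : Lasso vert π x h, b'.edges = b.edges → ∀ j < b'.l, P (b'.w j) ∧ P (π (b'.w j))) :
    ∀ a ∈ b.edges, P a := by
  intro a ha
  have h1 := hw b rfl
  have h2 := hw b.swap b.edges_swap
  simp only [edges, mem_union, mem_image, mem_range] at ha
  rcases ha with (⟨j, hj, rfl⟩ | ⟨j, hj, rfl⟩) | ⟨_, ⟨j, hj, rfl⟩ | ⟨j, hj, rfl⟩, rfl⟩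
  exacts [(h1 j hj).1, (h2 j hj).1, (h1 j hj).2, (h2 j hj).2]

/-- Every vertex other than the initial one is incident to two half-edges of the lasso. -/
lemma exists_ne_mem_edges (b : Lasso vert π x h) (hinv : ∀ x, π (π x) = x) :
    ∀ a ∈ b.edges, vert a = vert x ∨ ∃ a' ∈ b.edges, a' ≠ a ∧ vert a' = vert a := by
  refine b.induction_edges fun b' hb' j hj => ⟨?_, ?_⟩
  · rw [← hb']
    rcases j with _ | j
    · exact Or.inl (by rw [b'.start])
    · have hs := b'.step j (by omega)
      exact Or.inr ⟨π (b'.w j), b'.apply_mem hinv (b'.w_mem (by omega)), hs.2, hs.1⟩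
  · rw [← hb']
    have hs := b'.step j hj
    refine Or.inr ?_
    by_cases hjl : j + 1 < b'.l
    · exact ⟨_, b'.w_mem hjl, hs.2.symm, hs.1.symm⟩
    obtain hl | hl | htail : h = b'.l ∨ h = b'.l' ∨ (h ≠ b'.l ∧ h ≠ b'.l') := by omega
    · exact ⟨b'.w (j + 1), b'.w_mem_of_le (by omega), hs.2.symm, hs.1.symm⟩
    · refine ⟨b'.w (j + 1), ?_, hs.2.symm, hs.1.symm⟩
      have hjl : j + 1 = b'.l := by omega
      rw [hjl, b'.last, ← hl, ← b'.agree _ le_rfl]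
      exact b'.w_mem_of_le le_rfl
    · have h2 := b'.le_l'
      have ht : b'.w (b'.l - 1) ≠ b'.w' (b'.l' - 1) := by
        rcases b'.tail with h | h | h
        exacts [absurd h.symm htail.1, absurd h.symm htail.2, h]
      obtain ⟨i, hi⟩ : ∃ i, b'.l' = i + 1 := ⟨b'.l' - 1, by omega⟩
      have hjl : b'.l = j + 1 := by omega
      have hs' := b'.step' i (by omega)
      simp only [hi, hjl, Nat.add_sub_cancel] at ht
      refine ⟨π (b'.w' i), b'.apply_mem hinv (b'.w'_mem (by omega)), ?_, ?_⟩
      · exact fun heq => ht (π.injective heq).symm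
      · rw [hs'.1, hs.1, ← hi, ← hjl, b'.last]

lemma exists_mem_edges_notMem [DecidableEq V] (b : Lasso vert π x h)
    {D : Finset H} (hD : ∀ a ∈ D, π a ∈ D) (hbD : ¬ b.edges ⊆ D) :
    ∃ a ∈ b.edges, a ∉ D ∧ vert a ∈ insert (vert x) (D.image vert) := by
  have key : ∃ b' : Lasso vert π x h, b'.edges = b.edges ∧ ∃ j, j < b'.l ∧ b'.w j ∉ D := by
    by_contra! hcon
    exact hbD (b.induction_edges fun b' hb' j hj => ⟨hcon b' hb' j hj, hD _ (hcon b' hb' j hj)⟩)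
  obtain ⟨b', hb', hex⟩ := key
  have hmin := Nat.find_spec hex
  refine ⟨b'.w (Nat.find hex), hb' ▸ b'.w_mem hmin.1, hmin.2, ?_⟩
  rcases hj : Nat.find hex with _ | j
  · rw [b'.start]
    exact mem_insert_self _ _
  · have hlt : j < b'.l := by omega
    have hjD : b'.w j ∈ D := by
      by_contra hn
      exact Nat.find_min hex (m := j) (by omega) ⟨hlt, hn⟩
    rw [← (b'.step j hlt).1]
    exact mem_insert_of_mem (mem_image_of_mem _ (hD _ hjD))

lemma card_edges_le (b : Lasso vert π x h) : b.edges.card ≤ 6 * h := by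
  have hsub : (range b.l).image b.w ∪ (range b.l').image b.w' ⊆
      ((range b.l).image b.w) ∪ (Ico h b.l').image b.w' := by
    intro a ha
    simp only [mem_union, mem_image, mem_range, mem_Ico] at ha ⊢
    rcases ha with ha | ⟨j, hj, rfl⟩
    · exact Or.inl ha
    · by_cases hjh : j < h
      · exact Or.inl ⟨j, hjh.trans_le b.le_l, b.agree j hjh.le⟩
      · exact Or.inr ⟨j, ⟨by omega, hj⟩, rfl⟩
  have h1 := (Finset.card_le_card hsub).trans (Finset.card_union_le _ _)
  have h2 := Finset.card_image_le (s := range b.l) (f := b.w)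
  have h3 := Finset.card_image_le (s := Ico h b.l') (f := b.w')
  have h4 := Finset.card_union_le ((range b.l).image b.w ∪ (range b.l').image b.w')
    (((range b.l).image b.w ∪ (range b.l').image b.w').image π)
  have h5 := Finset.card_image_le (s := (range b.l).image b.w ∪ (range b.l').image b.w') (f := π)
  have h6 := b.l_le
  have h7 := b.l'_le
  simp only [card_range, Nat.card_Ico] at h2 h3
  rw [edges]
  omega

end Lasso

/-- A set `F` of matched half-edges in which `x` is the only one at its vertex, `v` carries at most
three, every other vertex at most two, and `X` leads from `x` to `v` in `m + 1` steps. -/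
structure Stem (vert : H → V) (π : Equiv.Perm H) (F : Finset H) (x : H) (v : V)
    (X : ℕ → H) (m : ℕ) : Prop where
  invol : ∀ y, π (π y) = y
  apply_mem : ∀ a ∈ F, π a ∈ F
  root : ∀ a ∈ F, vert a = vert x → a = x
  two : ∀ a ∈ F, ∀ b ∈ F, ∀ c ∈ F, vert a = vert b → vert a = vert c → vert a ≠ v →
    a = b ∨ a = c ∨ b = c
  three : ∀ a ∈ F, ∀ b ∈ F, ∀ c ∈ F, ∀ d ∈ F, vert a = v → vert b = v → vert c = v → vert d = v →
    a = b ∨ a = c ∨ a = d ∨ b = c ∨ b = d ∨ c = d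
  start : X 0 = x
  mem : ∀ j ≤ m, X j ∈ F
  step : ∀ j < m, vert (π (X j)) = vert (X (j + 1)) ∧ π (X j) ≠ X (j + 1)
  vert_ne : ∀ j ≤ m, vert (X j) ≠ v
  vert_end : vert (π (X m)) = v

namespace Stem

variable {vert : H → V} {π : Equiv.Perm H} {F : Finset H} {x : H} {v : V}
  {X : ℕ → H} {m h : ℕ}

lemma eq_of_vert_eq (S : Stem vert π F x v X m) {i : ℕ} (hi : 0 < i) (him : i ≤ m) {a : H}
    (ha : a ∈ F) (hv : vert a = vert (X i)) (hne : a ≠ X i) : a = π (X (i - 1)) := by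
  obtain ⟨i, rfl⟩ : ∃ k, i = k + 1 := ⟨i - 1, by omega⟩
  have hs := S.step i (by omega)
  have := S.two _ ha _ (S.mem _ him) _ (S.apply_mem _ (S.mem i (by omega))) hv
    (hv.trans hs.1.symm) (hv ▸ S.vert_ne _ him)
  rcases this with h | h | h
  exacts [absurd h hne, h, absurd h.symm hs.2]

lemma vert_injOn (S : Stem vert π F x v X m) {i j : ℕ} (hij : i < j) (hjm : j ≤ m) :
    vert (X i) ≠ vert (X j) := by
  induction i generalizing j with
  | zero =>
    intro heq
    obtain ⟨j, rfl⟩ : ∃ k, j = k + 1 := ⟨j - 1, by omega⟩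
    rw [S.start] at heq
    have hs := S.step j (by omega)
    have h1 := S.root _ (S.mem _ hjm) heq.symm
    have h2 := S.root _ (S.apply_mem _ (S.mem j (by omega))) (hs.1.trans heq.symm)
    exact hs.2 (h2.trans h1.symm)
  | succ i ih =>
    intro heq
    obtain ⟨j, rfl⟩ : ∃ k, j = k + 1 := ⟨j - 1, by omega⟩
    have hs := S.step i (by omega)
    by_cases hX : X (i + 1) = X (j + 1)
    · have h1 := S.eq_of_vert_eq (i := j + 1) (by omega) hjm
        (S.apply_mem _ (S.mem i (by omega))) (hs.1.trans heq) (hX ▸ hs.2)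
      exact ih (j := j) (by omega) (by omega) (congrArg vert (π.injective h1))
    · have h1 : X (j + 1) = π (X i) := S.eq_of_vert_eq (i := i + 1) (by omega) (by omega)
        (S.mem _ hjm) heq.symm (Ne.symm hX)
      have h2 : vert (π (X (j + 1))) = vert (X i) := by rw [h1, S.invol]
      rcases hjm.lt_or_eq with hlt | rfl
      · exact ih (j := j + 2) (by omega) (by omega) (h2.symm.trans (S.step (j + 1) hlt).1)
      · exact S.vert_ne i (by omega) (h2.symm.trans S.vert_end)

lemma eq_of_le (S : Stem vert π F x v X m) {z : ℕ → H} {L : ℕ} (hz0 : z 0 = x)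
    (hz : ∀ j ≤ L, z j ∈ F)
    (hstep : ∀ j < L, vert (π (z j)) = vert (z (j + 1)) ∧ π (z j) ≠ z (j + 1))
    {j : ℕ} (hjm : j ≤ m) (hjL : j ≤ L) : z j = X j := by
  induction j with
  | zero => rw [hz0, S.start]
  | succ j ih =>
    have hj := ih (by omega) (by omega)
    by_contra hne
    have hs := hstep j (by omega)
    rw [hj] at hs
    have h1 := S.step j (by omega)
    exact hs.2
      (S.eq_of_vert_eq (i := j + 1) (by omega) hjm (hz _ hjL) (hs.1.symm.trans h1.1) hne).symm

lemma ne_of_lt (S : Stem vert π F x v X m) {z : ℕ → H} {L : ℕ} (hz : ∀ j ≤ L, z j ∈ F)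
    (hstep : ∀ j < L, vert (π (z j)) = vert (z (j + 1)) ∧ π (z j) ≠ z (j + 1))
    {i t : ℕ} (him : i ≤ m) (hit : i < t) (htL : t ≤ L) : z t ≠ X i := by
  induction i generalizing t with
  | zero =>
    intro heq
    obtain ⟨t, rfl⟩ : ∃ k, t = k + 1 := ⟨t - 1, by omega⟩
    have hs := hstep t (by omega)
    rw [heq, S.start] at hs
    exact hs.2 (S.root _ (S.apply_mem _ (hz t (by omega))) hs.1)
  | succ i ih =>
    intro heq
    obtain ⟨t, rfl⟩ : ∃ k, t = k + 1 := ⟨t - 1, by omega⟩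
    have hs := hstep t (by omega)
    rw [heq] at hs
    have := S.eq_of_vert_eq (i := i + 1) (by omega) him (S.apply_mem _ (hz t (by omega))) hs.1 hs.2
    exact ih (t := t) (by omega) (by omega) (by omega) (π.injective this)

/-- A path entering the stem backwards has to follow it until its start. -/
lemma backwards (S : Stem vert π F x v X m) {z : ℕ → H} {L t : ℕ} (hz : ∀ j < L, z j ∈ F)
    (hstep : ∀ j < L, vert (π (z j)) = vert (z (j + 1)) ∧ π (z j) ≠ z (j + 1))
    (ht : z t = π (X m)) {s : ℕ} (hs : t + s < L) : s ≤ m ∧ z (t + s) = π (X (m - s)) := by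
  induction s with
  | zero => exact ⟨Nat.zero_le _, ht⟩
  | succ s ih =>
    obtain ⟨hsm, heq⟩ := ih (by omega)
    have h1 := hstep (t + s) (by omega)
    rw [heq, S.invol] at h1
    have hmem := hz (t + s + 1) hs
    rcases hsm.lt_or_eq with hlt | rfl
    · refine ⟨hlt, ?_⟩
      have := S.eq_of_vert_eq (i := m - s) (by omega) (by omega) hmem h1.1.symm h1.2.symm
      rw [← add_assoc, this]
      congr 2
    · rw [Nat.sub_self, S.start] at h1
      exact absurd (S.root _ hmem h1.1.symm).symm h1.2

variable [DecidableEq H]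

/-- A lasso contained in `F` never enters the stem backwards during its first `h` steps. -/
lemma lasso_ne (S : Stem vert π F x v X m) (b : Lasso vert π x h) (hb : b.edges ⊆ F) {t : ℕ}
    (ht : t ≤ h) : b.w t ≠ π (X m) := by
  intro heq
  have heq' : b.w' t = π (X m) := (b.agree t ht) ▸ heq
  have hv : vert (b.w t) = v := by rw [heq, S.vert_end]
  have h1 := b.le_l
  have h2 := b.le_l'
  have back := fun s => S.backwards (s := s) (fun j hj => hb (b.w_mem hj)) b.step heq
  have back' := fun s => S.backwards (s := s) (fun j hj => hb (b.w'_mem hj)) b.step' heq'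
  have fin : t < b.l → vert (b.w b.l) = vert (X (m - (b.l - 1 - t))) := by
    intro hlt
    obtain ⟨-, hx⟩ := back (b.l - 1 - t) (by omega)
    have hs := (b.step (b.l - 1) (by omega)).1
    rw [show t + (b.l - 1 - t) = b.l - 1 by omega] at hx
    rw [show b.l - 1 + 1 = b.l by omega, hx, S.invol] at hs
    exact hs.symm
  have fin' : t < b.l' → vert (b.w' b.l') = vert (X (m - (b.l' - 1 - t))) := by
    intro hlt
    obtain ⟨-, hx⟩ := back' (b.l' - 1 - t) (by omega)
    have hs := (b.step' (b.l' - 1) (by omega)).1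
    rw [show t + (b.l' - 1 - t) = b.l' - 1 by omega] at hx
    rw [show b.l' - 1 + 1 = b.l' by omega, hx, S.invol] at hs
    exact hs.symm
  have hlt := b.h_lt
  have hlast := congrArg vert b.last
  rcases eq_or_ne t b.l with hl | hl
  · rw [← hl, hv, fin' (by omega)] at hlast
    exact S.vert_ne _ (by omega) hlast.symm
  rcases eq_or_ne t b.l' with hl' | hl'
  · rw [← hl', ← b.agree t ht, hv, fin (by omega)] at hlast
    exact S.vert_ne _ (by omega) hlast
  rw [fin (by omega), fin' (by omega)] at hlast
  have b1 := (back (b.l - 1 - t) (by omega)).1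
  have b2 := (back' (b.l' - 1 - t) (by omega)).1
  have hll : b.l = b.l' := by
    by_contra hne
    rcases lt_or_gt_of_ne hne with hlt | hlt
    · exact S.vert_injOn (i := m - (b.l' - 1 - t)) (j := m - (b.l - 1 - t)) (by omega) (by omega)
        hlast.symm
    · exact S.vert_injOn (i := m - (b.l - 1 - t)) (j := m - (b.l' - 1 - t)) (by omega) (by omega)
        hlast
  refine b.ne ⟨hll, fun j hj => ?_⟩
  rcases le_or_gt j t with hjt | hjt
  · exact b.agree j (by omega)
  rcases hj.lt_or_eq with hj | rfl
  · obtain ⟨s, rfl⟩ : ∃ s, j = t + s := ⟨j - t, by omega⟩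
    rw [(back s hj).2, (back' s (by omega)).2]
  · rw [b.last, hll]

lemma lasso_eq (S : Stem vert π F x v X m) (b₁ b₂ : Lasso vert π x h) (hb₁ : b₁.edges ⊆ F)
    (hb₂ : b₂.edges ⊆ F) (heq : b₁.w (m + 1) = b₂.w (m + 1)) {j : ℕ} (hj : j ≤ h) :
    b₁.w j = b₂.w j := by
  have hF₁ : ∀ j ≤ h, b₁.w j ∈ F := fun j hj => hb₁ (b₁.w_mem_of_le hj)
  have hF₂ : ∀ j ≤ h, b₂.w j ∈ F := fun j hj => hb₂ (b₂.w_mem_of_le hj)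
  have hs₁ := fun j (hj : j < h) => b₁.step j (hj.trans_le b₁.le_l)
  have hs₂ := fun j (hj : j < h) => b₂.step j (hj.trans_le b₂.le_l)
  rcases le_or_gt j m with hjm | hjm
  · rw [S.eq_of_le b₁.start hF₁ hs₁ hjm hj, S.eq_of_le b₂.start hF₂ hs₂ hjm hj]
  induction j, hjm using Nat.le_induction with
  | base => exact heq
  | succ j hjm ih =>
    have hj' := ih (by omega)
    have h1 := hs₁ j (by omega)
    have h2 := hs₂ j (by omega)
    rw [← hj'] at h2
    have hmem := S.apply_mem _ (hF₁ j (by omega))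
    by_cases hv : vert (π (b₁.w j)) = v
    · have hne : π (b₁.w j) ≠ π (X m) := fun hcon =>
        S.ne_of_lt hF₁ hs₁ le_rfl hjm (by omega) (π.injective hcon)
      have n1 := S.lasso_ne b₁ hb₁ hj
      have n2 := S.lasso_ne b₂ hb₂ hj
      have := S.three _ hmem _ (S.apply_mem _ (S.mem m le_rfl)) _ (hF₁ _ hj) _ (hF₂ _ hj) hv
        S.vert_end (h1.1.symm.trans hv) (h2.1.symm.trans hv)
      rcases this with h | h | h | h | h | h
      exacts [absurd h hne, absurd h h1.2, absurd h h2.2, absurd h.symm n1, absurd h.symm n2, h]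
    · rcases S.two _ hmem _ (hF₁ _ hj) _ (hF₂ _ hj) h1.1 h2.1 hv with h | h | h
      exacts [absurd h h1.2, absurd h h2.2, h]

end Stem

section DegreeSum

variable [DecidableEq V] {vert : H → V} {F : Finset H} {u v : V}

/-- If `F` has at most twice as many elements as vertices, and at least two elements at each vertex
except `u`, then a vertex `v` with three elements is unique and forces `u` to be a leaf. -/
lemma card_fibers_of_card_le (hu : u ∈ F.image vert)
    (h2 : ∀ a ∈ F, vert a = u ∨ ∃ a' ∈ F, a' ≠ a ∧ vert a' = vert a)
    (hcard : F.card ≤ 2 * (F.image vert).card) (hv : 3 ≤ (F.filter fun a => vert a = v).card) :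
    u ≠ v ∧ (F.filter fun a => vert a = u).card ≤ 1 ∧ (F.filter fun a => vert a = v).card ≤ 3 ∧
      ∀ v' ≠ v, (F.filter fun a => vert a = v').card ≤ 2 := by
  set I := F.image vert with hI
  set d : V → ℕ := fun v => (F.filter fun a => vert a = v).card with hd
  change 3 ≤ d v at hv
  change u ≠ v ∧ d u ≤ 1 ∧ d v ≤ 3 ∧ ∀ v' ≠ v, d v' ≤ 2
  have hsum : ∑ y ∈ I, d y ≤ 2 * I.card := (Finset.card_eq_sum_card_image vert F) ▸ hcard
  have hdu : 1 ≤ d u := by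
    obtain ⟨a, ha, hau⟩ := mem_image.1 hu
    exact Finset.card_pos.2 ⟨a, by simp [ha, hau]⟩
  have hd2 : ∀ y ∈ I, y ≠ u → 2 ≤ d y := by
    intro y hy hyu
    obtain ⟨a, ha, rfl⟩ := mem_image.1 hy
    obtain h | ⟨a', ha', hne, hva⟩ := h2 a ha
    · exact absurd h hyu
    · exact Finset.one_lt_card.2 ⟨a, by simp [ha], a', by simp [ha', hva], hne.symm⟩
  have hmem : ∀ y, 0 < d y → y ∈ I := by
    intro y hy
    obtain ⟨a, ha⟩ := Finset.card_pos.1 hy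
    rw [mem_filter] at ha
    exact mem_image.2 ⟨a, ha⟩
  have hrest : ∀ J ⊆ I, u ∉ J → J.card * 2 ≤ ∑ y ∈ J, d y := fun J hJ huJ => by
    rw [← smul_eq_mul]
    exact Finset.card_nsmul_le_sum _ _ _ fun y hy => hd2 y (hJ hy) fun h => huJ (h ▸ hy)
  have s1 := Finset.add_sum_erase I d hu
  have c1 := Finset.card_erase_add_one hu
  have huv : u ≠ v := by
    rintro rfl
    have := hrest (I.erase u) (Finset.erase_subset _ _) (by simp)
    omega
  have hv1 : v ∈ I.erase u := Finset.mem_erase.2 ⟨huv.symm, hmem v (by omega)⟩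
  have s2 := Finset.add_sum_erase _ d hv1
  have c2 := Finset.card_erase_add_one hv1
  have r2 := hrest ((I.erase u).erase v)
    ((Finset.erase_subset _ _).trans (Finset.erase_subset _ _)) (by simp)
  refine ⟨huv, by omega, by omega, fun y hy => ?_⟩
  by_contra! hcon
  rcases eq_or_ne y u with rfl | hyu
  · omega
  have hy1 : y ∈ (I.erase u).erase v :=
    Finset.mem_erase.2 ⟨hy, Finset.mem_erase.2 ⟨hyu, hmem y (by omega)⟩⟩
  have s3 := Finset.add_sum_erase _ d hy1
  have c3 := Finset.card_erase_add_one hy1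
  have r3 := hrest (((I.erase u).erase v).erase y)
    ((Finset.erase_subset _ _).trans
      ((Finset.erase_subset _ _).trans (Finset.erase_subset _ _))) (by simp)
  omega

end DegreeSum

/-- Three lassos whose first `h` steps are pairwise distinct create two collisions. -/
lemma hasCollisions_of_lassos [DecidableEq H] [DecidableEq V] {vert : H → V} {π : Equiv.Perm H}
    {x : H} {h : ℕ} (hinv : ∀ x, π (π x) = x) (hfix : ∀ x, π x ≠ x)
    (b₁ b₂ b₃ : Lasso vert π x h) (h₁₂ : ∃ j ≤ h, b₁.w j ≠ b₂.w j) (h₁₃ : ∃ j ≤ h, b₁.w j ≠ b₃.w j)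
    (h₂₃ : ∃ j ≤ h, b₂.w j ≠ b₃.w j) :
    HasCollisions vert π (9 * h) 2 {vert x} ∅ := by
  set F := b₁.edges ∪ b₂.edges ∪ b₃.edges with hF
  have hb₁ : b₁.edges ⊆ F := Finset.subset_union_left.trans Finset.subset_union_left
  have hb₂ : b₂.edges ⊆ F := Finset.subset_union_right.trans Finset.subset_union_left
  have hb₃ : b₃.edges ⊆ F := Finset.subset_union_right
  have hsplit : ∀ a ∈ F, ∃ b : Lasso vert π x h, b.edges ⊆ F ∧ a ∈ b.edges := by
    intro a ha
    rcases Finset.mem_union.1 ha with ha | ha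
    · rcases Finset.mem_union.1 ha with ha | ha
      exacts [⟨b₁, hb₁, ha⟩, ⟨b₂, hb₂, ha⟩]
    · exact ⟨b₃, hb₃, ha⟩
  have hFπ : ∀ a ∈ F, π a ∈ F := fun a ha => by
    obtain ⟨b, hb, hab⟩ := hsplit a ha
    exact hb (b.apply_mem hinv hab)
  have hleaf : ∀ a ∈ F, vert a = vert x ∨ ∃ a' ∈ F, a' ≠ a ∧ vert a' = vert a := fun a ha => by
    obtain ⟨b, hb, hab⟩ := hsplit a ha
    obtain h | ⟨a', ha', hne, hv⟩ := b.exists_ne_mem_edges hinv a hab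
    exacts [Or.inl h, Or.inr ⟨a', hb ha', hne, hv⟩]
  have hxF : x ∈ F := by
    have := hb₁ (b₁.w_mem_of_le (Nat.zero_le _))
    rwa [b₁.start] at this
  have hFcard : F.card ≤ 2 * (9 * h) := by
    have := b₁.card_edges_le
    have := b₂.card_edges_le
    have := b₃.card_edges_le
    have := Finset.card_union_le (b₁.edges ∪ b₂.edges) b₃.edges
    have := Finset.card_union_le b₁.edges b₂.edges
    rw [hF]
    omega
  have hconn : ∀ D ⊆ F, (∀ a ∈ D, π a ∈ D) → D ≠ F →
      ∃ a ∈ F, a ∉ D ∧ vert a ∈ insert (vert x) (D.image vert) := by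
    intro D hDF hD hne
    obtain ⟨a, haF, haD⟩ := Finset.exists_of_ssubset (hDF.ssubset_of_ne hne)
    obtain ⟨b, hb, hab⟩ := hsplit a haF
    obtain ⟨a', ha', h'⟩ := b.exists_mem_edges_notMem hD fun hsub => haD (hsub hab)
    exact ⟨a', hb ha', h'⟩
  clear_value F
  by_contra hcon
  have hcard : F.card ≤ 2 * (F.image vert).card := by
    by_contra! hlt
    refine hcon ?_
    have := hasCollisions_of_connected hinv hfix hFπ hconn (9 * h) 2 ∅ (by simp) (by simp)
      (by simpa using hFcard) ?_
    · simpa using this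
    · have hmem : vert x ∈ F.image vert := mem_image_of_mem _ hxF
      have := Finset.card_erase_add_one hmem
      rw [Finset.image_empty, insert_empty_eq, Finset.sdiff_singleton_eq_erase, Finset.sdiff_empty]
      omega
  have hFw : ∀ b : Lasso vert π x h, b.edges ⊆ F → ∀ j ≤ h, b.w j ∈ F :=
    fun b hb j hj => hb (b.w_mem_of_le hj)
  have hfork := Nat.find_spec h₁₂
  obtain ⟨t, ht⟩ : ∃ t, Nat.find h₁₂ = t + 1 := by
    refine ⟨Nat.find h₁₂ - 1, ?_⟩
    have : Nat.find h₁₂ ≠ 0 := fun h0 => by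
      rw [h0, b₁.start, b₂.start] at hfork
      exact hfork.2 rfl
    omega
  rw [ht] at hfork
  have hteq : b₁.w t = b₂.w t := by
    by_contra hne
    exact Nat.find_min h₁₂ (m := t) (by omega) ⟨by omega, hne⟩
  have hl₁ := b₁.le_l
  have hl₂ := b₂.le_l
  have hl₃ := b₃.le_l
  have hs₁ := b₁.step t (by omega)
  have hs₂ := b₂.step t (by omega)
  rw [← hteq] at hs₂
  set v := vert (π (b₁.w t)) with hv
  have hv3 : 3 ≤ (F.filter fun a => vert a = v).card := by
    refine Finset.two_lt_card.2 ⟨π (b₁.w t), ?_, b₁.w (t + 1), ?_, b₂.w (t + 1), ?_, hs₁.2, hs₂.2,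
      hfork.2⟩
    · exact mem_filter.2 ⟨hFπ _ (hFw b₁ hb₁ _ (by omega)), rfl⟩
    · exact mem_filter.2 ⟨hFw b₁ hb₁ _ (by omega), hs₁.1.symm⟩
    · exact mem_filter.2 ⟨hFw b₂ hb₂ _ (by omega), hs₂.1.symm⟩
  obtain ⟨huv, hdu, hdv, hd⟩ := card_fibers_of_card_le (mem_image_of_mem _ hxF) hleaf hcard hv3
  have hex : ∃ m, vert (π (b₁.w m)) = v := ⟨t, rfl⟩
  have hmt : Nat.find hex ≤ t := Nat.find_min' hex rfl
  have hmend := Nat.find_spec hex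
  have hmmin : ∀ j < Nat.find hex, vert (π (b₁.w j)) ≠ v := fun j hj => Nat.find_min hex hj
  generalize Nat.find hex = m at hmt hmend hmmin
  have S : Stem vert π F x v b₁.w m :=
    { invol := hinv
      apply_mem := hFπ
      root := fun a ha hau => Finset.card_le_one.1 hdu a (by simp [ha, hau]) x (by simp [hxF])
      two := fun a ha b hb c hc hab hac hav => by
        by_contra! hne
        refine absurd (hd _ hav) (not_le.2 (Finset.two_lt_card.2
          ⟨a, mem_filter.2 ⟨ha, rfl⟩, b, mem_filter.2 ⟨hb, hab.symm⟩, c,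
            mem_filter.2 ⟨hc, hac.symm⟩, hne.1, hne.2.1, hne.2.2⟩))
      three := fun a ha b hb c hc d hd' hav hbv hcv hdv' => by
        by_contra! hne
        obtain ⟨n1, n2, n3, n4, n5, n6⟩ := hne
        have hsub : ({a, b, c, d} : Finset H) ⊆ F.filter fun a => vert a = v := by
          intro y hy
          simp only [mem_insert, mem_singleton] at hy
          rcases hy with rfl | rfl | rfl | rfl
          exacts [mem_filter.2 ⟨ha, hav⟩, mem_filter.2 ⟨hb, hbv⟩, mem_filter.2 ⟨hc, hcv⟩,
            mem_filter.2 ⟨hd', hdv'⟩]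
        have := (Finset.card_le_card hsub).trans hdv
        rw [Finset.card_insert_of_notMem (by simp [*]), Finset.card_insert_of_notMem (by simp [*]),
          Finset.card_pair n6] at this
        omega
      start := b₁.start
      mem := fun j hj => hFw b₁ hb₁ j (by omega)
      step := fun j hj => b₁.step j (by omega)
      vert_ne := fun j hj => by
        rcases j with _ | j
        · rwa [b₁.start]
        · rw [← (b₁.step j (by omega)).1]
          exact hmmin j (by omega)
      vert_end := hmend }
  have hnext : ∀ b : Lasso vert π x h, b.edges ⊆ F →
      b.w (m + 1) ∈ F ∧ vert (b.w (m + 1)) = v ∧ b.w (m + 1) ≠ π (b₁.w m) := by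
    intro b hb
    have hl := b.le_l
    refine ⟨hFw b hb _ (by omega), ?_, S.lasso_ne b hb (by omega)⟩
    rw [← (b.step m (by omega)).1, S.eq_of_le (L := h) b.start (hFw b hb)
      (fun j hj => b.step j (by omega)) le_rfl (by omega), hmend]
  obtain ⟨m1, v1, n1⟩ := hnext b₁ hb₁
  obtain ⟨m2, v2, n2⟩ := hnext b₂ hb₂
  obtain ⟨m3, v3, n3⟩ := hnext b₃ hb₃
  rcases S.three _ (hFπ _ (S.mem m le_rfl)) _ m1 _ m2 _ m3 hmend v1 v2 v3 with e | e | e | e | e | e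
  · exact n1 e.symm
  · exact n2 e.symm
  · exact n3 e.symm
  · obtain ⟨j, hj, hne⟩ := h₁₂
    exact hne (S.lasso_eq b₁ b₂ hb₁ hb₂ e hj)
  · obtain ⟨j, hj, hne⟩ := h₁₃
    exact hne (S.lasso_eq b₁ b₃ hb₁ hb₃ e hj)
  · obtain ⟨j, hj, hne⟩ := h₂₃
    exact hne (S.lasso_eq b₂ b₃ hb₂ hb₃ e hj)

end Lasso

section Concatenation

variable {H V : Type*} {vert : H → V} {π : Equiv.Perm H} {h : ℕ} {w z z' : ℕ → H} {m m' : ℕ}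

/-- The walk `w` followed for `h` steps, and the walk `z` afterwards. -/
def concatWalk (h : ℕ) (w z : ℕ → H) (i : ℕ) : H := if i ≤ h then w i else z (i - h)

lemma concatWalk_of_le {i : ℕ} (hi : i ≤ h) : concatWalk h w z i = w i := if_pos hi

lemma concatWalk_add (hz0 : z 0 = w h) (i : ℕ) : concatWalk h w z (h + i) = z i := by
  rcases i with _ | i
  · simp [concatWalk, hz0]
  · simp [concatWalk]

lemma concatWalk_step (hw : ∀ j < h, vert (π (w j)) = vert (w (j + 1)) ∧ π (w j) ≠ w (j + 1))
    (hz0 : z 0 = w h) (hz : ∀ j < m, vert (π (z j)) = vert (z (j + 1)) ∧ π (z j) ≠ z (j + 1))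
    {j : ℕ} (hj : j < h + m) :
    vert (π (concatWalk h w z j)) = vert (concatWalk h w z (j + 1)) ∧
      π (concatWalk h w z j) ≠ concatWalk h w z (j + 1) := by
  rcases lt_or_ge j h with hjh | hjh
  · rw [concatWalk_of_le hjh.le, concatWalk_of_le hjh]
    exact hw j hjh
  · obtain ⟨i, rfl⟩ := Nat.exists_eq_add_of_le hjh
    rw [add_assoc, concatWalk_add hz0, concatWalk_add hz0]
    exact hz i (by omega)

lemma exists_lasso_of_tail
    (hw : ∀ j < h, vert (π (w j)) = vert (w (j + 1)) ∧ π (w j) ≠ w (j + 1))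
    (hm : m ≤ h) (hm' : m' ≤ h) (hz0 : z 0 = w h) (hz0' : z' 0 = w h)
    (hz : ∀ j < m, vert (π (z j)) = vert (z (j + 1)) ∧ π (z j) ≠ z (j + 1))
    (hz' : ∀ j < m', vert (π (z' j)) = vert (z' (j + 1)) ∧ π (z' j) ≠ z' (j + 1))
    (hend : z m = z' m') (hne : ¬ (m = m' ∧ ∀ j ≤ m, z j = z' j))
    (htail : m = 0 ∨ m' = 0 ∨ z (m - 1) ≠ z' (m' - 1)) :
    ∃ b : Lasso vert π (w 0) h, ∀ j ≤ h, b.w j = w j := by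
  refine ⟨{ w := concatWalk h w z, w' := concatWalk h w z', l := h + m, l' := h + m'
            le_l := by omega
            le_l' := by omega
            l_le := by omega
            l'_le := by omega
            start := concatWalk_of_le (Nat.zero_le _)
            agree := fun j hj => by rw [concatWalk_of_le hj, concatWalk_of_le hj]
            step := fun j hj => concatWalk_step hw hz0 hz hj
            step' := fun j hj => concatWalk_step hw hz0' hz' hj
            last := by rw [concatWalk_add hz0, concatWalk_add hz0', hend]
            ne := fun ⟨h1, h2⟩ => hne ⟨by omega, fun j hj => ?_⟩
            tail := ?_ }, fun j hj => concatWalk_of_le hj⟩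
  · have := h2 (h + j) (by omega)
    rwa [concatWalk_add hz0, concatWalk_add hz0'] at this
  · rcases m with _ | m
    · exact Or.inl rfl
    rcases m' with _ | m'
    · exact Or.inr (Or.inl rfl)
    right; right
    rw [← add_assoc, ← add_assoc, Nat.add_sub_cancel, Nat.add_sub_cancel, concatWalk_add hz0,
      concatWalk_add hz0']
    simpa using htail

/-- A walk continuing along two distinct walks with the same end creates a lasso. -/
lemma exists_lasso
    (hw : ∀ j < h, vert (π (w j)) = vert (w (j + 1)) ∧ π (w j) ≠ w (j + 1))
    (hm : m ≤ h) (hm' : m' ≤ h) (hz0 : z 0 = w h) (hz0' : z' 0 = w h)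
    (hz : ∀ j < m, vert (π (z j)) = vert (z (j + 1)) ∧ π (z j) ≠ z (j + 1))
    (hz' : ∀ j < m', vert (π (z' j)) = vert (z' (j + 1)) ∧ π (z' j) ≠ z' (j + 1))
    (hend : z m = z' m') (hne : ¬ (m = m' ∧ ∀ j ≤ m, z j = z' j)) :
    ∃ b : Lasso vert π (w 0) h, ∀ j ≤ h, b.w j = w j := by
  induction m generalizing m' with
  | zero => exact exists_lasso_of_tail hw hm hm' hz0 hz0' hz hz' hend hne (Or.inl rfl)
  | succ m ih =>
    rcases m' with _ | m'
    · exact exists_lasso_of_tail hw hm hm' hz0 hz0' hz hz' hend hne (Or.inr (Or.inl rfl))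
    by_cases hpen : z m = z' m'
    · refine ih (by omega) (m' := m') (by omega) (fun j hj => hz j (by omega))
        (fun j hj => hz' j (by omega)) hpen ?_
      rintro ⟨rfl, hj⟩
      refine hne ⟨rfl, fun j hjm => ?_⟩
      rcases hjm.lt_or_eq with h | rfl
      exacts [hj j (by omega), hend]
    · exact exists_lasso_of_tail hw hm hm' hz0 hz0' hz hz' hend hne (Or.inr (Or.inr hpen))

end Concatenation

section Paths

variable {k : ℕ} {dg : Fin k → ℕ} {π : Equiv.Perm (HE k dg)}

lemma IsNBPath.getD_step {p : List (HE k dg)} (hp : IsNBPath π p) {x : HE k dg} {j : ℕ}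
    (hj : j + 1 < p.length) :
    (π (p.getD j x)).1 = (p.getD (j + 1) x).1 ∧ π (p.getD j x) ≠ p.getD (j + 1) x := by
  induction p generalizing j with
  | nil => simp at hj
  | cons a p ih =>
    rcases p with _ | ⟨b, p⟩
    · simp at hj
    rcases j with _ | j
    · simpa using hp.1
    · simpa using ih hp.2 (j := j) (by simpa using hj)

lemma getD_zero_of_head? {α : Type*} {p : List α} {y x : α} (hp : p.head? = some y) :
    p.getD 0 x = y := by
  rcases p with _ | ⟨a, p⟩ <;> simp_all

lemma getLast?_eq_getD {α : Type*} {p : List α} (x : α) (hp : p ≠ []) :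
    p.getLast? = some (p.getD (p.length - 1) x) := by
  rw [List.getLast?_eq_getElem?, List.getD_eq_getElem?_getD]
  have : p.length - 1 < p.length := Nat.sub_lt (List.length_pos_iff.2 hp) one_pos
  simp [List.getElem?_eq_getElem this]

/-- A non-backtracking path of length `h` ending outside the roots extends to a lasso. -/
lemma exists_lasso_of_not_isRoot {h : ℕ} {x y : HE k dg} {p : List (HE k dg)} (hp : IsNBPath π p)
    (hx : p.head? = some x) (hlen : p.length = h + 1) (hy : p.getLast? = some y)
    (hroot : ¬ IsRoot dg π h y) :
    ∃ b : Lasso Sigma.fst π x h, ∀ j ≤ h, b.w j = p.getD j x := by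
  have hp0 := getD_zero_of_head? (x := x) hx
  have hph : p.getD h x = y := by
    rw [getLast?_eq_getD x (by rintro rfl; simp at hlen), hlen] at hy
    simpa using hy
  simp only [IsRoot] at hroot
  push Not at hroot
  obtain ⟨q, q', hq, hq', hqy, hqy', hql, hql', hlast, hne⟩ := hroot
  have hqn : q ≠ [] := by rintro rfl; simp at hqy
  have hqn' : q' ≠ [] := by rintro rfl; simp at hqy'
  have hpos := List.length_pos_iff.2 hqn
  have hpos' := List.length_pos_iff.2 hqn'
  rw [getLast?_eq_getD x hqn, getLast?_eq_getD x hqn', Option.some_inj] at hlast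
  have key := exists_lasso (vert := Sigma.fst) (π := π) (h := h) (w := fun j => p.getD j x)
    (z := fun j => q.getD j x) (z' := fun j => q'.getD j x) (m := q.length - 1)
    (m' := q'.length - 1) (fun j hj => hp.getD_step (by omega)) (by omega) (by omega)
    ((getD_zero_of_head? hqy).trans hph.symm) ((getD_zero_of_head? hqy').trans hph.symm)
    (fun j hj => hq.getD_step (by omega)) (fun j hj => hq'.getD_step (by omega)) hlast ?_
  · beta_reduce at key
    rwa [hp0] at key
  · rintro ⟨h1, h2⟩
    refine hne (List.ext_getElem (by omega) fun i hi hi' => ?_)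
    have := h2 i (by omega)
    simpa [List.getD_eq_getElem?_getD, hi, hi'] using this

/-- The non-backtracking paths with `h` steps starting at `x`. -/
def nbPaths (π : Equiv.Perm (HE k dg)) : ℕ → HE k dg → Finset (List (HE k dg))
  | 0, x => {[x]}
  | h + 1, x => (univ.filter fun y => (π x).1 = y.1 ∧ π x ≠ y).biUnion fun y =>
      (nbPaths π h y).image (List.cons x)

lemma mem_nbPaths {h : ℕ} {x : HE k dg} {p : List (HE k dg)} (hp : p ∈ nbPaths π h x) :
    IsNBPath π p ∧ p.head? = some x ∧ p.length = h + 1 := by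
  induction h generalizing x p with
  | zero =>
    obtain rfl : p = [x] := by simpa [nbPaths] using hp
    simp [IsNBPath]
  | succ h ih =>
    simp only [nbPaths, mem_biUnion, mem_filter, mem_univ, true_and, mem_image] at hp
    obtain ⟨y, hy, q, hq, rfl⟩ := hp
    obtain ⟨hq1, hq2, hq3⟩ := ih hq
    rcases q with _ | ⟨a, q⟩
    · simp at hq2
    obtain rfl : a = y := by simpa using hq2
    exact ⟨⟨hy, hq1⟩, rfl, by simp [hq3]⟩

lemma sum_nbrwP_pow_le (hmin : ∀ v, 3 ≤ dg v) (T : Finset (HE k dg)) (h : ℕ) (x : HE k dg) :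
    ∑ y ∈ T, (nbrwP dg π ^ h) x y ≤
      (1 / 2) ^ h * ((nbPaths π h x).filter fun p => ∃ y ∈ T, p.getLast? = some y).card := by
  induction h generalizing x with
  | zero =>
    by_cases hx : x ∈ T
    · simp [Matrix.one_apply, nbPaths, Finset.filter_singleton, hx, -Sigma.exists]
    · simp [Matrix.one_apply, nbPaths, hx]
  | succ h ih =>
    set C := univ.filter fun y => (π x).1 = y.1 ∧ π x ≠ y with hC
    set B : ℕ → HE k dg → Finset (List (HE k dg)) := fun h x =>
      (nbPaths π h x).filter fun p => ∃ y ∈ T, p.getLast? = some y with hB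
    have hcard : ∑ z ∈ C, (B h z).card ≤ (B (h + 1) x).card := by
      have hdisj : (C : Set (HE k dg)).PairwiseDisjoint
          fun z => (B h z).image (List.cons x) := by
        intro z _ z' _ hzz'
        rw [Function.onFun, Finset.disjoint_left]
        intro p hp hp'
        obtain ⟨q, hq, rfl⟩ := mem_image.1 hp
        obtain ⟨q', hq', he⟩ := mem_image.1 hp'
        obtain rfl : q' = q := by simpa using he
        have h1 := (mem_nbPaths (mem_filter.1 hq).1).2.1
        have h2 := (mem_nbPaths (mem_filter.1 hq').1).2.1
        exact hzz' (by simpa [h1] using h2)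
      calc ∑ z ∈ C, (B h z).card = ∑ z ∈ C, ((B h z).image (List.cons x)).card :=
            Finset.sum_congr rfl fun z _ =>
              (Finset.card_image_of_injective _ List.cons_injective).symm
        _ = (C.biUnion fun z => (B h z).image (List.cons x)).card :=
            (Finset.card_biUnion hdisj).symm
        _ ≤ (B (h + 1) x).card := by
            refine Finset.card_le_card fun p hp => ?_
            obtain ⟨z, hz, hp⟩ := mem_biUnion.1 hp
            obtain ⟨q, hq, rfl⟩ := mem_image.1 hp
            obtain ⟨hq, y, hy, hqy⟩ := mem_filter.1 hq
            refine mem_filter.2 ⟨mem_biUnion.2 ⟨z, hz, mem_image_of_mem _ hq⟩, y, hy, ?_⟩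
            rw [List.getLast?_cons, hqy]
            rfl
    have h3 : (3 : ℝ) ≤ dg (π x).1 := by exact_mod_cast hmin _
    have hP : ((dg (π x).1 : ℝ) - 1)⁻¹ ≤ 1 / 2 := by
      rw [one_div]
      exact inv_anti₀ two_pos (by linarith)
    have hP0 : 0 ≤ ((dg (π x).1 : ℝ) - 1)⁻¹ := inv_nonneg.2 (by linarith)
    calc ∑ y ∈ T, (nbrwP dg π ^ (h + 1)) x y
        = ∑ z ∈ C, ((dg (π x).1 : ℝ) - 1)⁻¹ * ∑ y ∈ T, (nbrwP dg π ^ h) z y := by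
          simp_rw [pow_succ', Matrix.mul_apply, Finset.mul_sum]
          rw [Finset.sum_comm, hC, Finset.sum_filter]
          refine Finset.sum_congr rfl fun z _ => ?_
          simp only [nbrwP, ite_mul, zero_mul]
          split_ifs <;> simp
      _ ≤ ∑ z ∈ C, (1 / 2) * ((1 / 2) ^ h * ((B h z).card : ℝ)) := by
          refine Finset.sum_le_sum fun z _ => ?_
          exact (mul_le_mul_of_nonneg_left (ih z) hP0).trans
            (mul_le_mul_of_nonneg_right hP (by positivity))
      _ = (1 / 2) ^ (h + 1) * ((∑ z ∈ C, (B h z).card : ℕ) : ℝ) := by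
          rw [← Finset.mul_sum, ← Finset.mul_sum, pow_succ']
          push_cast
          ring
      _ ≤ _ := by gcongr

end Paths

section Probability

variable {k : ℕ} {dg : Fin k → ℕ}

lemma sum_nbrwP_pow_le_of_not_hasCollisions {π : Equiv.Perm (HE k dg)} (hπ : IsPairing π)
    (hmin : ∀ v, 3 ≤ dg v) {h : ℕ} {x : HE k dg}
    (hcol : ¬ HasCollisions Sigma.fst π (9 * h) 2 {x.1} ∅) :
    ∑ y ∈ univ.filter (fun y => ¬ IsRoot dg π h y), (nbrwP dg π ^ h) x y ≤ 2 * (1 / 2) ^ h := by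
  refine (sum_nbrwP_pow_le hmin _ h x).trans ?_
  rw [mul_comm]
  gcongr
  suffices h2 : ((nbPaths π h x).filter fun p =>
      ∃ y ∈ univ.filter (fun y => ¬ IsRoot dg π h y), p.getLast? = some y).card ≤ 2 by
    exact_mod_cast h2
  by_contra! hcard
  obtain ⟨p₁, hp₁, p₂, hp₂, p₃, hp₃, h₁₂, h₁₃, h₂₃⟩ := Finset.two_lt_card.1 hcard
  have key : ∀ p ∈ (nbPaths π h x).filter fun p =>
      ∃ y ∈ univ.filter (fun y => ¬ IsRoot dg π h y), p.getLast? = some y,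
      p.length = h + 1 ∧ ∃ b : Lasso Sigma.fst π x h, ∀ j ≤ h, b.w j = p.getD j x := by
    intro p hp
    obtain ⟨hp, y, hy, hpy⟩ := mem_filter.1 hp
    obtain ⟨hp, hx, hlen⟩ := mem_nbPaths hp
    exact ⟨hlen, exists_lasso_of_not_isRoot hp hx hlen hpy (mem_filter.1 hy).2⟩
  obtain ⟨l₁, b₁, hb₁⟩ := key p₁ hp₁
  obtain ⟨l₂, b₂, hb₂⟩ := key p₂ hp₂
  obtain ⟨l₃, b₃, hb₃⟩ := key p₃ hp₃
  have hne : ∀ {p q : List (HE k dg)} {b b' : Lasso Sigma.fst π x h}, p.length = h + 1 →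
      q.length = h + 1 → (∀ j ≤ h, b.w j = p.getD j x) → (∀ j ≤ h, b'.w j = q.getD j x) → p ≠ q →
      ∃ j ≤ h, b.w j ≠ b'.w j := by
    intro p q b b' hp hq hb hb' hpq
    by_contra! hcon
    refine hpq (List.ext_getElem (by omega) fun i hi hi' => ?_)
    have := hcon i (by omega)
    rw [hb i (by omega), hb' i (by omega)] at this
    simpa [List.getD_eq_getElem?_getD, hi, hi'] using this
  exact hcol (hasCollisions_of_lassos hπ.1 hπ.2 b₁ b₂ b₃ (hne l₁ l₂ hb₁ hb₂ h₁₂)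
    (hne l₁ l₃ hb₁ hb₃ h₁₃) (hne l₂ l₃ hb₂ hb₃ h₂₃))

lemma card_filter_fst_le (v : Fin k) :
    (univ.filter fun y : HE k dg => y.1 = v).card ≤ DeltaD dg := by
  have : (univ.filter fun y : HE k dg => y.1 = v) ⊆ univ.image (Sigma.mk v) := by
    rintro ⟨u, i⟩ hu
    obtain rfl : u = v := by simpa using hu
    simp
  calc _ ≤ _ := (Finset.card_le_card this).trans Finset.card_image_le
    _ = dg v := by simp
    _ ≤ DeltaD dg := Finset.le_sup (mem_univ v)

lemma card_halfEdges : Fintype.card (HE k dg) = Nh dg := by simp [Nh]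

lemma prP_not_isRoot_le (hmin : ∀ v, 3 ≤ dg v) {h : ℕ} {δ s : ℝ} (hδ : 2 * (1 / 2) ^ h ≤ δ)
    (hs : (9 * h + 1) * DeltaD dg ≤ s) (hs1 : 1 ≤ s) (hN : 18 * h < Nh dg) :
    (prP dg fun π => δ < ⨆ x, ∑ y ∈ univ.filter (fun y => ¬ IsRoot dg π h y),
        (nbrwP dg π ^ h) x y) ≤
      Nh dg * ((2 * s) ^ (9 * h) * (s / (Nh dg - 18 * h)) ^ 2) := by
  have hN' : (18 * h : ℝ) < Nh dg := by exact_mod_cast hN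
  have hpos : 0 < (Nh dg : ℝ) - 18 * h := by linarith
  set K : ℝ := (2 * s) ^ (9 * h) * (s / (Nh dg - 18 * h)) ^ 2 with hK
  have hK0 : 0 ≤ K := by positivity
  have hne : Nonempty (HE k dg) := by
    rw [← Fintype.card_pos_iff, card_halfEdges]
    omega
  set A : HE k dg → Finset (Equiv.Perm (HE k dg)) := fun x => (PairingsF dg).filter fun π =>
    HasCollisions Sigma.fst π (9 * h) 2 {x.1} ∅ with hA
  have hpair : pairingsAgreeing ∅ (1 : Equiv.Perm (HE k dg)) = PairingsF dg := by
    ext π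
    simp only [pairingsAgreeing, PairingsF, IsPairing, mem_filter]
    simp
  have hcardA : ∀ x, ((A x).card : ℝ) ≤ K * (PairingsF dg).card := by
    intro x
    have := card_hasCollisions_le (vert := (Sigma.fst : HE k dg → Fin k)) (Δ := DeltaD dg) (s := s)
      (ε := s / (Nh dg - 18 * h)) card_filter_fst_le hs1 (by positivity) (9 * h) 2 {x.1} ∅ 1
      (by simp) (by push_cast; simpa [add_comm] using hs) (le_of_eq ?_)
    · rwa [hpair] at this
    · rw [card_halfEdges, Finset.card_empty]
      push_cast
      rw [sub_zero, show (2 : ℝ) * (9 * h) = 18 * h by ring, div_mul_cancel₀ _ hpos.ne']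
  have hsub : (PairingsF dg).filter (fun π => δ < ⨆ x,
      ∑ y ∈ univ.filter (fun y => ¬ IsRoot dg π h y), (nbrwP dg π ^ h) x y) ⊆ univ.biUnion A := by
    intro π hπ
    obtain ⟨hπ, hlt⟩ := mem_filter.1 hπ
    obtain ⟨x, hx⟩ := exists_lt_of_lt_ciSup hlt
    refine mem_biUnion.2 ⟨x, mem_univ x, mem_filter.2 ⟨hπ, ?_⟩⟩
    by_contra hcol
    exact absurd (sum_nbrwP_pow_le_of_not_hasCollisions (mem_filter.1 hπ).2 hmin hcol)
      (not_le.2 (hδ.trans_lt hx))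
  refine div_le_of_le_mul₀ (by positivity) (by positivity) ?_
  calc _ ≤ ((univ.biUnion A).card : ℝ) := by exact_mod_cast Finset.card_le_card hsub
    _ ≤ ∑ x, ((A x).card : ℝ) := by exact_mod_cast Finset.card_biUnion_le
    _ ≤ ∑ _x : HE k dg, K * (PairingsF dg).card := Finset.sum_le_sum fun x _ => hcardA x
    _ = Nh dg * K * (PairingsF dg).card := by
      rw [Finset.sum_const, nsmul_eq_mul, Finset.card_univ, card_halfEdges]
      ring

end Probability

section Asymptotics

lemma mul_pow_mul_sq_le_exp {N D : ℝ} {h : ℕ} (hN : 0 < N) (hD : 1 < D)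
    (hlog : 1 ≤ Real.log (Real.log N)) (hh : (h : ℝ) ≤ Real.log (Real.log N))
    (hhD : (h : ℝ) * (10 * Real.log D) ≤ Real.log N) (hND : Real.log D ≤ Real.log N / 100)
    (hloglog : Real.log (Real.log N) ^ 2 ≤ Real.log N / 22000) (hNh : 18 * (h : ℝ) ≤ N / 2) :
    N * ((2 * ((9 * h + 1) * D)) ^ (9 * h) * ((9 * h + 1) * D / (N - 18 * h)) ^ 2) ≤
      Real.exp (-(7 / 100) * Real.log N) := by
  set L := Real.log N with hL
  have hs : 0 < 2 * ((9 * (h : ℝ) + 1) * D) := by positivity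
  have hNh' : 0 < N - 18 * h := by linarith
  calc N * ((2 * ((9 * h + 1) * D)) ^ (9 * h) * ((9 * h + 1) * D / (N - 18 * h)) ^ 2)
      ≤ N * ((2 * ((9 * h + 1) * D)) ^ (9 * h) * ((9 * h + 1) * D / (N / 2)) ^ 2) := by
        gcongr
        linarith
    _ = (2 * ((9 * h + 1) * D)) ^ (9 * h + 2) / N := by
        rw [pow_add]
        field_simp
    _ = Real.exp ((9 * h + 2) * Real.log (2 * ((9 * h + 1) * D)) - L) := by
        rw [Real.exp_sub, hL, Real.exp_log hN]
        congr 1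
        rw [← Real.exp_log hs, ← Real.exp_nat_mul, Real.log_exp]
        push_cast
        ring_nf
    _ ≤ _ := by
        rw [Real.exp_le_exp]
        have h1 : Real.log (2 * ((9 * h + 1) * D)) ≤ 2 * (9 * h + 1) + Real.log D := by
          rw [← mul_assoc, Real.log_mul (by positivity) (by positivity)]
          gcongr
          exact (Real.log_le_sub_one_of_pos (by positivity)).trans (by linarith)
        have h2 : (9 * (h : ℝ) + 2) * (2 * (9 * h + 1)) ≤ 11 * Real.log L * (20 * Real.log L) := by
          exact mul_le_mul (by linarith) (by linarith) (by positivity) (by linarith)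
        have h3 := mul_le_mul_of_nonneg_left h1 (show 0 ≤ 9 * (h : ℝ) + 2 by positivity)
        nlinarith

variable {k : ℕ} {dg : Fin k → ℕ}

lemma three_le_DeltaD (hmin : ∀ v, 3 ≤ dg v) (hN : 0 < Nh dg) : 3 ≤ DeltaD dg := by
  obtain ⟨v, -, -⟩ := Finset.exists_ne_zero_of_sum_ne_zero hN.ne'
  exact (hmin v).trans (Finset.le_sup (mem_univ v))

end Asymptotics

/-- **Roots are quickly reached**: `max_x P^h(x, X ∖ R) → 0` in probability, where
`R` is the set of roots and `h = ⌊min(log N/(10 log Δ), log log N)⌋`. -/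
theorem roots_quickly_reached
    (k : ℕ → ℕ) (dg : ∀ n, Fin (k n) → ℕ)
    (hN : Tendsto (fun n => (Nh (dg n) : ℝ)) atTop atTop)
    (heven : ∀ n, Even (Nh (dg n)))
    (hmin : ∀ n v, 3 ≤ dg n v)
    (hΔ : Tendsto (fun n => Real.log (DeltaD (dg n)) / Real.log (Nh (dg n)))
      atTop (nhds 0))
    (h1 : Tendsto (fun n =>
        sigsq (dg n) / muD (dg n) ^ 3 * Real.log (Nh (dg n)) /
          Real.log (Real.log (Nh (dg n))) ^ 2) atTop atTop)
    (h2 : Tendsto (fun n =>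
        Real.sqrt (sigsq (dg n)) ^ 3 / (rhoD (dg n) * Real.sqrt (muD (dg n))) *
          Real.sqrt (Real.log (Nh (dg n)))) atTop atTop)
    :
    ∀ δ > 0, Tendsto (fun n => prP (dg n) fun π =>
      δ < ⨆ x, ∑ y ∈ univ.filter (fun y => ¬ IsRoot (dg n) π (hrad (dg n)) y),
            ((nbrwP (dg n) π) ^ (hrad (dg n))) x y) atTop (nhds 0) := by
  intro δ hδ
  have hL := Real.tendsto_log_atTop.comp hN
  have hLL := Real.tendsto_log_atTop.comp hL
  simp only [Function.comp_def] at hL hLL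
  have hD3 : ∀ᶠ n in atTop, (3 : ℝ) ≤ DeltaD (dg n) := by
    filter_upwards [hN.eventually_gt_atTop 0] with n hn
    exact_mod_cast three_le_DeltaD (hmin n) (by exact_mod_cast hn)
  have hhtop : Tendsto (fun n => hrad (dg n)) atTop atTop := by
    refine tendsto_nat_floor_atTop.comp (tendsto_atTop.2 fun b => ?_)
    have hpos : ∀ᶠ n in atTop, 0 < Real.log (DeltaD (dg n)) / Real.log (Nh (dg n)) := by
      filter_upwards [hL.eventually_gt_atTop 0, hD3] with n hn hD
      exact div_pos (Real.log_pos (by linarith)) hn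
    have := (tendsto_inv_nhdsGT_zero.comp (tendsto_nhdsWithin_iff.2 ⟨hΔ, hpos⟩)).const_mul_atTop
      (show (0 : ℝ) < 1 / 10 by norm_num)
    filter_upwards [this.eventually_ge_atTop b, hLL.eventually_ge_atTop b] with n hn hn'
    refine le_min (hn.trans_eq ?_) hn'
    simp only [Function.comp_apply, inv_div]
    rw [div_mul_div_comm, one_mul]
  have hδ' : ∀ᶠ n in atTop, 2 * (1 / 2 : ℝ) ^ hrad (dg n) ≤ δ := by
    have := ((tendsto_pow_atTop_nhds_zero_of_lt_one (r := (1 / 2 : ℝ)) (by norm_num)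
      (by norm_num)).comp hhtop).const_mul 2
    rw [mul_zero] at this
    exact this.eventually_le_const hδ
  have hsmall : ∀ᶠ n in atTop, Real.log (Real.log (Nh (dg n))) ^ 2 ≤
      Real.log (Nh (dg n)) / 22000 := by
    have := hL.eventually ((Real.isLittleO_pow_log_id_atTop (n := 2)).bound
      (show (0 : ℝ) < 1 / 22000 by norm_num))
    filter_upwards [this, hL.eventually_gt_atTop 0] with n hn hpos
    rw [id, Real.norm_of_nonneg (by positivity), Real.norm_of_nonneg hpos.le] at hn
    linarith
  have hlogN : ∀ᶠ n in atTop, Real.log (Nh (dg n)) ≤ Nh (dg n) / 100 := by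
    have := hN.eventually (Real.isLittleO_log_id_atTop.bound (show (0 : ℝ) < 1 / 100 by norm_num))
    filter_upwards [this, hL.eventually_gt_atTop 0] with n hn hpos
    rw [id, Real.norm_of_nonneg hpos.le, Real.norm_of_nonneg (by positivity)] at hn
    linarith
  have hlim : Tendsto (fun n => Real.exp (-(7 / 100) * Real.log (Nh (dg n)))) atTop (nhds 0) :=
    Real.tendsto_exp_atBot.comp (hL.const_mul_atTop_of_neg (by norm_num))
  refine squeeze_zero' (Eventually.of_forall fun n => by unfold prP; positivity) ?_ hlim
  filter_upwards [hD3, hδ', hsmall, hlogN, hN.eventually_gt_atTop 0, hL.eventually_gt_atTop 0,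
    hLL.eventually_ge_atTop 1, hΔ.eventually_le_const (show (0 : ℝ) < 1 / 100 by norm_num)]
    with n hD hδn hsq hNn hN0 hL0 hLL1 hΔn
  have hΛ : 0 < Real.log (DeltaD (dg n)) := Real.log_pos (by linarith)
  have hfloor : (hrad (dg n) : ℝ) ≤ _ := Nat.floor_le (le_min (by positivity) (by linarith))
  have hh := hfloor.trans (min_le_right _ _)
  have hhD := hfloor.trans (min_le_left _ _)
  rw [le_div_iff₀ (by positivity)] at hhD
  rw [div_le_iff₀ hL0] at hΔn
  have hlogL : Real.log (Real.log (Nh (dg n))) ≤ Real.log (Nh (dg n)) := Real.log_le_self hL0.le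
  refine (prP_not_isRoot_le (hmin n) hδn le_rfl ?_ ?_).trans
    (mul_pow_mul_sq_le_exp hN0 (by linarith) hLL1 hh hhD (by linarith) hsq (by linarith))
  · have : (0 : ℝ) ≤ hrad (dg n) := by positivity
    nlinarith
  · have : (18 * hrad (dg n) : ℝ) < Nh (dg n) := by linarith
    exact_mod_cast this

end
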